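/- Let F be a field and let C ⊆ Fⁿ be a linear code of dimension k ≥ 1 with locality r ≥ 1, i.e., for every coordinate i ∈ {1,…,n} there exist a set S_i ⊆ {1,…,n} \ {i} with |S_i| ≤ r and coefficients λ_{ij} ∈ F such that c_i = Σ_{j ∈ S_i} λ_{ij} c_j for every codeword c ∈ C. Then the minimum distance d of C (the minimum Hamming weight of a nonzero codeword) satisfies d ≤ n − k − ⌈k/r⌉ + 2. -/

import Mathlib

open Submodule Module in
theorem finrank_span_image_union_le {F V ι : Type*} [Field F] [AddCommGroup V] [Module F V]
    [FiniteDimensional F V] [DecidableEq ι] (φ : ι → V) (A S : Finset ι) :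
    finrank F (span F (φ '' ↑(A ∪ S))) ≤ finrank F (span F (φ '' ↑A)) + (S \ A).card := by
  classical
  rw [← Finset.union_sdiff_self_eq_union, Finset.coe_union, Set.image_union, span_union]
  refine (Submodule.finrank_add_le_finrank_add_finrank _ _).trans ?_
  gcongr
  rw [← Finset.coe_image]
  exact (finrank_span_finset_le_card _).trans Finset.card_image_le

open Submodule Module in
theorem exists_notMem_span_of_finrank_lt {F V ι : Type*} [Field F] [AddCommGroup V] [Module F V]
    {φ : ι → V} (hφ : span F (Set.range φ) = ⊤) {W : Submodule F V}
    (hW : finrank F W < finrank F V) : ∃ i, φ i ∉ W := by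
  by_contra! h
  have htop : W = ⊤ := top_le_iff.1 (hφ ▸ span_le.2 (Set.range_subset_iff.2 h))
  rw [htop, finrank_top] at hW
  exact hW.false

open Submodule Module in
/-- If each vector of a spanning family lies in the span of at most `r` others, there are index
sets whose cardinality exceeds the rank by any `t` with `t * r < dim V`, up to rank `t * r`. -/
theorem exists_finset_finrank_span_add_le_card {F V ι : Type*} [Field F] [AddCommGroup V]
    [Module F V] [FiniteDimensional F V] {φ : ι → V} (hφ : span F (Set.range φ) = ⊤) {r : ℕ}
    (hloc : ∀ i, ∃ S : Finset ι, i ∉ S ∧ S.card ≤ r ∧ φ i ∈ span F (φ '' ↑S))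
    (t : ℕ) (ht : (t - 1) * r < finrank F V) :
    ∃ A : Finset ι, finrank F (span F (φ '' ↑A)) ≤ t * r ∧
      finrank F (span F (φ '' ↑A)) + t ≤ A.card := by
  classical
  induction t with
  | zero => exact ⟨∅, by simp, by simp⟩
  | succ t ih =>
    rw [Nat.add_sub_cancel] at ht
    obtain ⟨A, hA, hcard⟩ := ih ((Nat.mul_le_mul_right r (Nat.sub_le t 1)).trans_lt ht)
    obtain ⟨i, hi⟩ := exists_notMem_span_of_finrank_lt hφ (hA.trans_lt ht)
    obtain ⟨S, hiS, hSr, hiSpan⟩ := hloc i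
    have hiA : i ∉ A := fun h ↦ hi (subset_span (Set.mem_image_of_mem φ h))
    have hspan : span F (φ '' ↑(insert i (A ∪ S))) = span F (φ '' ↑(A ∪ S)) := by
      rw [Finset.coe_insert, Set.image_insert_eq]
      refine span_insert_eq_span (span_mono (Set.image_mono ?_) hiSpan)
      exact Finset.coe_subset.2 Finset.subset_union_right
    have hle := finrank_span_image_union_le (F := F) φ A S
    have hsdiff : (S \ A).card ≤ S.card := Finset.card_le_card Finset.sdiff_subset
    have hunion : (A ∪ S).card = A.card + (S \ A).card := by
      rw [← Finset.union_sdiff_self_eq_union, Finset.card_union_of_disjoint Finset.disjoint_sdiff]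
    have hins : (insert i (A ∪ S)).card = (A ∪ S).card + 1 :=
      Finset.card_insert_of_notMem (by simp [hiA, hiS])
    refine ⟨insert i (A ∪ S), ?_, ?_⟩ <;> rw [hspan]
    · rw [Nat.succ_mul]
      omega
    · omega

open Submodule Module in
theorem exists_finset_finrank_span_le_add {F V ι : Type*} [Field F] [AddCommGroup V]
    [Module F V] [FiniteDimensional F V] {φ : ι → V} (hφ : span F (Set.range φ) = ⊤)
    (A : Finset ι) (j : ℕ) (hj : finrank F (span F (φ '' ↑A)) + j ≤ finrank F V) :
    ∃ B : Finset ι, finrank F (span F (φ '' ↑B)) ≤ finrank F (span F (φ '' ↑A)) + j ∧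
      A.card + j ≤ B.card := by
  classical
  induction j with
  | zero => exact ⟨A, le_rfl, le_rfl⟩
  | succ j ih =>
    obtain ⟨B, hB, hcard⟩ := ih (by omega)
    obtain ⟨i, hi⟩ := exists_notMem_span_of_finrank_lt hφ
      (W := span F (φ '' ↑B)) (by omega)
    have hiB : i ∉ B := fun h ↦ hi (subset_span (Set.mem_image_of_mem φ h))
    have hle := finrank_span_image_union_le (F := F) φ B {i}
    have hsdiff : ({i} \ B : Finset ι).card ≤ 1 :=
      (Finset.card_le_card Finset.sdiff_subset).trans_eq (Finset.card_singleton i)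
    have hunion : (B ∪ {i}).card = B.card + 1 := by
      rw [Finset.card_union_of_disjoint (Finset.disjoint_singleton_right.2 hiB),
        Finset.card_singleton]
    exact ⟨B ∪ {i}, by omega, by omega⟩

open Module in
theorem exists_ne_zero_forall_dual_eq_zero {F V : Type*} [Field F] [AddCommGroup V] [Module F V]
    [FiniteDimensional F V] {W : Submodule F (Dual F V)} (hW : finrank F W < finrank F V) :
    ∃ v : V, v ≠ 0 ∧ ∀ f ∈ W, f v = 0 := by
  have hsum := Subspace.finrank_add_finrank_dualCoannihilator_eq W
  have hbot : W.dualCoannihilator ≠ ⊥ := by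
    intro h
    rw [h, finrank_bot] at hsum
    omega
  obtain ⟨v, hv, hv0⟩ := Submodule.exists_mem_ne_zero_of_ne_bot hbot
  exact ⟨v, hv0, (Submodule.mem_dualCoannihilator v).1 hv⟩

open Module in
theorem span_range_coord_eq_top {F ι : Type*} [Field F] [Finite ι] (C : Submodule F (ι → F)) :
    Submodule.span F (Set.range fun i ↦ (LinearMap.proj i).comp C.subtype) =
      (⊤ : Submodule F (Dual F C)) := by
  by_contra h
  have hlt := Submodule.finrank_lt h
  rw [Subspace.dual_finrank_eq] at hlt
  obtain ⟨c, hc, hzero⟩ := exists_ne_zero_forall_dual_eq_zero hlt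
  exact hc (Subtype.ext (funext fun i ↦ hzero _ (Submodule.subset_span ⟨i, rfl⟩)))

/-- **Singleton-type bound for locally recoverable codes (Theorem 2.3).**
Let `F` be a field and `C ⊆ Fⁿ` a linear code of dimension `k ≥ 1` with locality `r ≥ 1`:
for every coordinate `i` there are a set `S i ⊆ {1,…,n} \ {i}` with `|S i| ≤ r` and
coefficients `lam` such that `c i = Σ_{j ∈ S i} lam j * c j` for every codeword `c ∈ C`.
Then the minimum distance `d` of `C` (the minimum Hamming weight of a nonzero codeword)
satisfies `d ≤ n − k − ⌈k/r⌉ + 2`. -/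
theorem lrc_singleton_bound {F : Type*} [Field F] [DecidableEq F]
    (n k r d : ℕ) (hk : 1 ≤ k) (hr : 1 ≤ r)
    (C : Submodule F (Fin n → F))
    (hdim : Module.finrank F C = k)
    (hloc : ∀ i : Fin n, ∃ S : Finset (Fin n), i ∉ S ∧ S.card ≤ r ∧
      ∃ lam : Fin n → F, ∀ c ∈ C, c i = ∑ j ∈ S, lam j * c j)
    (hd_ex : ∃ c ∈ C, c ≠ 0 ∧ hammingNorm c = d)
    (hd_min : ∀ c ∈ C, c ≠ 0 → d ≤ hammingNorm c) :
    (d : ℤ) ≤ (n : ℤ) - (k : ℤ) - ⌈(k : ℚ) / (r : ℚ)⌉ + 2 := by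
  let φ : Fin n → Module.Dual F C := fun i ↦ (LinearMap.proj i).comp C.subtype
  have hφ : Submodule.span F (Set.range φ) = ⊤ := span_range_coord_eq_top C
  have hfin : Module.finrank F (Module.Dual F C) = k := by
    rw [Subspace.dual_finrank_eq, hdim]
  have hφloc : ∀ i, ∃ S : Finset (Fin n), i ∉ S ∧ S.card ≤ r ∧
      φ i ∈ Submodule.span F (φ '' ↑S) := by
    intro i
    obtain ⟨S, hiS, hSr, lam, hlam⟩ := hloc i
    refine ⟨S, hiS, hSr, ?_⟩
    have hsum : φ i = ∑ j ∈ S, lam j • φ j := by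
      ext c
      simpa [φ] using hlam c c.2
    rw [hsum]
    exact Submodule.sum_mem _ fun j hj ↦
      Submodule.smul_mem _ _ (Submodule.subset_span (Set.mem_image_of_mem φ hj))
  set t := (k - 1) / r
  have htr : t * r ≤ k - 1 := Nat.div_mul_le_self _ _
  have htr' : (t - 1) * r ≤ t * r := Nat.mul_le_mul_right r (Nat.sub_le t 1)
  obtain ⟨A, hA, hAcard⟩ :=
    exists_finset_finrank_span_add_le_card hφ hφloc t (by omega)
  obtain ⟨B, hB, hBcard⟩ := exists_finset_finrank_span_le_add hφ A
    (k - 1 - Module.finrank F (Submodule.span F (φ '' ↑A))) (by omega)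
  obtain ⟨c, hc, hzero⟩ := exists_ne_zero_forall_dual_eq_zero
    (W := Submodule.span F (φ '' ↑B)) (by omega)
  have hweight : hammingNorm (c : Fin n → F) ≤ Bᶜ.card := by
    refine Finset.card_le_card fun i hi ↦ Finset.mem_compl.2 fun hiB ↦ ?_
    exact (Finset.mem_filter.1 hi).2
      (hzero (φ i) (Submodule.subset_span (Set.mem_image_of_mem φ hiB)))
  have hd := hd_min c c.2 (by simpa using hc)
  have hBle : B.card ≤ n := by simpa using B.card_le_univ
  rw [Finset.card_compl, Fintype.card_fin] at hweight
  have hceil : ⌈(k : ℚ) / (r : ℚ)⌉ ≤ (t : ℤ) + 1 := by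
    have hlt : k ≤ (t + 1) * r := by
      have hlt' : k - 1 < (t + 1) * r :=
        Nat.lt_mul_of_div_lt (Nat.lt_succ_self t) hr
      omega
    rw [Int.ceil_le, div_le_iff₀ (by exact_mod_cast hr)]
    exact_mod_cast hlt
  omega
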